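/- Assuming the Continuum Hypothesis, for every real number s ∈ (0,1] there exists a Hamel basis B of ℝ over ℚ with Hausdorff dimension dim_H(B) = s. -/

import Mathlib

open MeasureTheory Filter Set
open scoped ENNReal Pointwise Cardinal

/-- A Hamel basis: a basis of ℝ as a vector space over ℚ, viewed as a subset of ℝ. -/
def IsHamelBasis (B : Set ℝ) : Prop :=
  LinearIndependent ℚ ((↑) : B → ℝ) ∧ Submodule.span ℚ B = ⊤

open Cardinal in
theorem cantorFunction_nonneg {c : ℝ} (hc : 0 ≤ c) (a : ℕ → Bool) : 0 ≤ cantorFunction c a :=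
  tsum_nonneg fun _ => cantorFunctionAux_nonneg hc

open Cardinal in
theorem cantorFunction_le_two {c : ℝ} (hc : 0 ≤ c) (hc' : c ≤ 1 / 2) (a : ℕ → Bool) :
    cantorFunction c a ≤ 2 := by
  have h1 : c < 1 := by linarith
  calc cantorFunction c a ≤ cantorFunction c (fun _ => true) :=
        cantorFunction_le hc h1 fun _ _ => rfl
    _ = (1 - c)⁻¹ := by simp [cantorFunction, cantorFunctionAux, tsum_geometric_of_lt_one hc h1]
    _ ≤ 2 := by
        rw [inv_le_comm₀ (by linarith) (by norm_num)]
        linarith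

open Cardinal in
theorem cantorFunction_sub_of_agree {c : ℝ} (hc : 0 ≤ c) (hc' : c < 1) (n : ℕ) {a b : ℕ → Bool}
    (h : ∀ k < n, a k = b k) :
    cantorFunction c a - cantorFunction c b =
      c ^ n * (cantorFunction c (fun k => a (k + n)) - cantorFunction c (fun k => b (k + n))) := by
  induction n generalizing a b with
  | zero => simp
  | succ n ih =>
    rw [cantorFunction_succ a hc hc', cantorFunction_succ b hc hc', h 0 n.succ_pos,
      add_sub_add_left_eq_sub, ← mul_sub, ih fun k hk => h (k + 1) (by lia), pow_succ', mul_assoc]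
    simp only [add_assoc]

open Cardinal in
theorem abs_cantorFunction_sub_le {c : ℝ} (hc : 0 ≤ c) (hc' : c ≤ 1 / 2) (n : ℕ) {a b : ℕ → Bool}
    (h : ∀ k < n, a k = b k) : |cantorFunction c a - cantorFunction c b| ≤ 2 * c ^ n := by
  rw [cantorFunction_sub_of_agree hc (by linarith) n h, abs_mul, abs_of_nonneg (pow_nonneg hc n),
    mul_comm]
  gcongr
  rw [abs_sub_le_iff]
  have := cantorFunction_nonneg hc
  have := cantorFunction_le_two hc hc'
  constructor <;> linarith [this fun k => a (k + n), this fun k => b (k + n),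
    cantorFunction_nonneg hc fun k => a (k + n), cantorFunction_nonneg hc fun k => b (k + n)]

open Cardinal in
theorem le_abs_cantorFunction_sub {c : ℝ} (hc : 0 ≤ c) (hc' : c ≤ 1 / 2) (n : ℕ) {a b : ℕ → Bool}
    (h : ∀ k < n, a k = b k) (hn : a n ≠ b n) :
    c ^ n * (1 - 2 * c) ≤ |cantorFunction c a - cantorFunction c b| := by
  have h1 : c < 1 := by linarith
  rw [cantorFunction_sub_of_agree hc h1 n h, abs_mul, abs_of_nonneg (pow_nonneg hc n)]
  gcongr
  rw [cantorFunction_succ _ hc h1, cantorFunction_succ (fun k => b (k + n)) hc h1]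
  have ha := mul_le_mul_of_nonneg_left
    (cantorFunction_le_two hc hc' fun k => a (k + 1 + n)) hc
  have hb := mul_le_mul_of_nonneg_left
    (cantorFunction_le_two hc hc' fun k => b (k + 1 + n)) hc
  have ha' := mul_nonneg hc (cantorFunction_nonneg hc fun k => a (k + 1 + n))
  have hb' := mul_nonneg hc (cantorFunction_nonneg hc fun k => b (k + 1 + n))
  rw [le_abs]
  rcases h₁ : a n <;> rcases h₂ : b n <;> simp_all
  · right; linarith
  · left; linarith

open Cardinal in
theorem Ico_subset_range_cantorFunction : Ico (0 : ℝ) 1 ⊆ range (cantorFunction (1 / 2)) := by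
  intro x hx
  refine ⟨fun n => Nat.casesOn n false fun k => Real.digits x 2 k = 1, ?_⟩
  rw [cantorFunction_succ _ (by norm_num) (by norm_num)]
  conv_rhs => rw [← Real.ofDigits_digits (b := 2) (by norm_num) hx]
  change 0 + 1 / 2 * cantorFunction (1 / 2) (fun k => decide (Real.digits x 2 k = 1)) = _
  rw [zero_add, cantorFunction, ← tsum_mul_left, Real.ofDigits]
  refine tsum_congr fun k => ?_
  rw [Real.ofDigitsTerm, cantorFunctionAux]
  generalize Real.digits x 2 k = d
  fin_cases d <;> simp [pow_succ', mul_comm]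

open Cardinal in
theorem dimH_range_cantorFunction_rpow_le {c r : ℝ} (hc : 0 < c) (hc' : c < 1 / 2) (hr : 0 < r)
    (hcr : c ^ r ≤ 1 / 2) :
    dimH (range (cantorFunction (c ^ r))) ≤
      dimH (range (cantorFunction c)) / ENNReal.ofReal r := by
  have hinj := cantorFunction_injective hc hc'
  set g : ℝ → ℝ := fun x => cantorFunction (c ^ r) (Function.invFun (cantorFunction c) x)
  have hg : range (cantorFunction (c ^ r)) = g '' range (cantorFunction c) := by
    rw [← range_comp]
    congr 1
    ext a
    simp [g, Function.leftInverse_invFun hinj a]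
  have h2c : 0 < 1 - 2 * c := by linarith
  have hcr0 : 0 ≤ c ^ r := by positivity
  have key : HolderOnWith (2 * (1 - 2 * c)⁻¹ ^ r).toNNReal r.toNNReal g
      (range (cantorFunction c)) := by
    rintro _ ⟨a, rfl⟩ _ ⟨b, rfl⟩
    simp only [g, Function.leftInverse_invFun hinj _]
    rcases eq_or_ne a b with rfl | hab
    · simp
    have hagree : ∀ k < PiNat.firstDiff a b, a k = b k :=
      fun k hk => PiNat.apply_eq_of_lt_firstDiff hk
    have hlow := le_abs_cantorFunction_sub hc.le hc'.le _ hagree (PiNat.apply_firstDiff_ne hab)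
    have hup := abs_cantorFunction_sub_le hcr0 hcr _ hagree
    generalize PiNat.firstDiff a b = n at hlow hup
    rw [edist_dist, edist_dist, Real.coe_toNNReal _ hr.le,
      ENNReal.ofReal_rpow_of_nonneg dist_nonneg hr.le, ← ENNReal.ofReal,
      ← ENNReal.ofReal_mul (by positivity), Real.dist_eq, Real.dist_eq]
    refine ENNReal.ofReal_le_ofReal (hup.trans ?_)
    rw [mul_assoc, ← Real.mul_rpow (by positivity) (by positivity)]
    gcongr 2 * ?_
    calc (c ^ r) ^ n = (c ^ n) ^ r := by
          rw [← Real.rpow_mul_natCast hc.le, ← Real.rpow_natCast_mul hc.le, mul_comm]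
      _ ≤ _ := by
          gcongr
          rwa [inv_mul_eq_div, le_div_iff₀ h2c]
  rw [hg]
  exact key.dimH_image_le (by simpa using hr)

open Cardinal in
theorem dimH_range_cantorFunction {s : ℝ} (hs₀ : 0 < s) (hs₁ : s < 1) :
    dimH (range (cantorFunction ((1 / 2 : ℝ) ^ (1 / s)))) = ENNReal.ofReal s := by
  have hlt : ∀ t : ℝ, 0 < t → t < 1 → (1 / 2 : ℝ) ^ (1 / t) < 1 / 2 := fun t h0 h1 => by
    conv_rhs => rw [← Real.rpow_one (1 / 2 : ℝ)]
    exact Real.rpow_lt_rpow_of_exponent_gt (by norm_num) (by norm_num) ((one_lt_div h0).2 h1)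
  apply le_antisymm
  · have hle : ∀ t ∈ Ioo s 1, dimH (range (cantorFunction ((1 / 2 : ℝ) ^ (1 / s)))) ≤
        ENNReal.ofReal (s / t) := by
      intro t ht
      have ht0 : 0 < t := hs₀.trans ht.1
      have heq : ((1 / 2 : ℝ) ^ (1 / t)) ^ (t / s) = (1 / 2 : ℝ) ^ (1 / s) := by
        rw [← Real.rpow_mul (by norm_num)]
        congr 1
        field_simp
      have := dimH_range_cantorFunction_rpow_le (c := (1 / 2 : ℝ) ^ (1 / t)) (by positivity)
        (hlt t ht0 ht.2) (div_pos ht0 hs₀) (heq ▸ (hlt s hs₀ hs₁).le)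
      rw [heq] at this
      refine this.trans ?_
      rw [← inv_div t s, ENNReal.ofReal_inv_of_pos (by positivity), ENNReal.div_eq_inv_mul]
      refine mul_le_of_le_one_right' ?_
      rw [← Real.dimH_univ]
      exact dimH_mono (subset_univ _)
    have hlim : Tendsto (fun t : ℝ => ENNReal.ofReal (s / t)) (nhdsWithin 1 (Iio 1))
        (nhds (ENNReal.ofReal s)) := by
      have : ContinuousAt (fun t : ℝ => ENNReal.ofReal (s / t)) 1 :=
        ENNReal.continuous_ofReal.continuousAt.comp
          (continuousAt_const.div continuousAt_id one_ne_zero)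
      simpa using this.tendsto.mono_left nhdsWithin_le_nhds
    exact ge_of_tendsto hlim (mem_of_superset (Ioo_mem_nhdsLT hs₁) hle)
  · have heq : ((1 / 2 : ℝ) ^ (1 / s)) ^ s = 1 / 2 := by
      rw [← Real.rpow_mul (by norm_num), one_div_mul_cancel hs₀.ne', Real.rpow_one]
    have := dimH_range_cantorFunction_rpow_le (c := (1 / 2 : ℝ) ^ (1 / s)) (by positivity)
      (hlt s hs₀ hs₁) hs₀ heq.le
    rw [heq] at this
    have hone : (1 : ℝ≥0∞) ≤ dimH (range (cantorFunction (1 / 2))) := by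
      refine le_trans ?_ (dimH_mono Ico_subset_range_cantorFunction)
      rw [Real.dimH_of_nonempty_interior (by simp)]
      simp
    have h := hone.trans this
    rwa [ENNReal.le_div_iff_mul_le (by simp [hs₀]) (by simp), one_mul] at h

theorem exists_dimH_eq_ofReal {s : ℝ} (hs₀ : 0 < s) (hs₁ : s ≤ 1) :
    ∃ C : Set ℝ, dimH C = ENNReal.ofReal s := by
  rcases hs₁.eq_or_lt with rfl | h
  · exact ⟨univ, by simp [Real.dimH_univ]⟩
  · exact ⟨_, dimH_range_cantorFunction hs₀ h⟩

theorem exists_dense_isGδ_dimH_eq_zero : ∃ Z : Set ℝ, IsGδ Z ∧ Dense Z ∧ dimH Z = 0 := by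
  set q := TopologicalSpace.denseSeq ℝ
  set t : ℕ → ℕ → Set ℝ := fun n i =>
    Ioo (q i - (1 / 2) ^ (n + i + 1)) (q i + (1 / 2) ^ (n + i + 1))
  have hopen : ∀ n, IsOpen (⋃ i, t n i) := fun n => isOpen_iUnion fun i => isOpen_Ioo
  have hdiam : ∀ n i, Metric.ediam (t n i) = ENNReal.ofReal ((1 / 2) ^ (n + i)) := fun n i => by
    rw [Real.ediam_Ioo]
    congr 1
    ring
  refine ⟨⋂ n, ⋃ i, t n i, .iInter_of_isOpen hopen, dense_iInter_of_isOpen hopen fun n => ?_, ?_⟩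
  · refine (TopologicalSpace.denseRange_denseSeq ℝ).mono ?_
    rintro _ ⟨i, rfl⟩
    exact mem_iUnion.2 ⟨i, by constructor <;> simp [q]⟩
  · rw [← nonpos_iff_eq_zero]
    refine dimH_le fun d hd => ?_
    by_contra! hpos
    have hd0 : 0 < (d : ℝ) := by simpa using hpos
    refine absurd hd (ne_of_lt ?_)
    have hr : Tendsto (fun n : ℕ => ENNReal.ofReal ((1 / 2) ^ n)) atTop (nhds 0) := by
      rw [← ENNReal.ofReal_zero]
      exact ENNReal.tendsto_ofReal
        (tendsto_pow_atTop_nhds_zero_of_lt_one (by norm_num) (by norm_num))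
    refine (Measure.hausdorffMeasure_le_liminf_tsum d _ _ hr t
      (.of_forall fun n i => ?_) (.of_forall fun n => iInter_subset _ n)).trans_lt ?_
    · rw [hdiam]
      exact ENNReal.ofReal_le_ofReal
        (pow_le_pow_of_le_one (by norm_num) (by norm_num) (Nat.le_add_right _ _))
    · have hlt : ENNReal.ofReal ((1 / 2) ^ (d : ℝ)) < 1 := by
        rw [ENNReal.ofReal_lt_one]
        exact Real.rpow_lt_one (by norm_num) (by norm_num) hd0
      have hbound : ∀ n, ∑' i, Metric.ediam (t n i) ^ (d : ℝ) ≤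
          (1 - ENNReal.ofReal ((1 / 2) ^ (d : ℝ)))⁻¹ := fun n => by
        rw [← ENNReal.tsum_geometric]
        refine ENNReal.tsum_le_tsum fun i => ?_
        rw [hdiam, ENNReal.ofReal_rpow_of_nonneg (by positivity) hd0.le,
          ← ENNReal.ofReal_pow (by positivity), ← Real.rpow_mul_natCast (by norm_num),
          mul_comm, Real.rpow_natCast_mul (by norm_num)]
        refine ENNReal.ofReal_le_ofReal (Real.rpow_le_rpow (by positivity) ?_ hd0.le)
        exact pow_le_pow_of_le_one (by norm_num) (by norm_num) (Nat.le_add_left _ _)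
      refine (liminf_le_of_le (a := (1 - ENNReal.ofReal ((1 / 2) ^ (d : ℝ)))⁻¹)
        (by isBoundedDefault) fun b hb => ?_).trans_lt ?_
      · obtain ⟨n, hn⟩ := hb.exists
        exact hn.trans (hbound n)
      · rw [ENNReal.inv_lt_top]
        exact tsub_pos_of_lt hlt

/-- A comeagre set of reals spans `ℝ`: it meets each of its reflections. -/
theorem span_rat_eq_top_of_dense_isGδ {Z : Set ℝ} (hZ : IsGδ Z) (hd : Dense Z) :
    Submodule.span ℚ Z = ⊤ := by
  refine Submodule.eq_top_iff'.2 fun x => ?_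
  have hd' : Dense ((fun z => x - z) ⁻¹' Z) := hd.preimage (Homeomorph.subLeft x).isOpenMap
  obtain ⟨z, hz, hz'⟩ :=
    (hd.inter_of_Gδ hZ (hZ.preimage (continuous_const.sub continuous_id)) hd').nonempty
  rw [← add_sub_cancel z x]
  exact add_mem (Submodule.subset_span hz) (Submodule.subset_span hz')

theorem linearIndependent_of_notMem_span_image_Iio {ι K V : Type*} [LinearOrder ι]
    [DivisionRing K] [AddCommGroup V] [Module K V] {v : ι → V}
    (h : ∀ i, v i ∉ Submodule.span K (v '' Iio i)) : LinearIndependent K v := by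
  rw [← linearIndepOn_univ_iff, linearIndepOn_iff_linearIndepOn_finset]
  intro t _
  induction t using Finset.induction_on_max with
  | empty => simp
  | insert a t ha ih =>
    rw [Finset.coe_insert, linearIndepOn_insert fun hat => (ha a hat).false]
    exact ⟨ih (subset_univ _), fun hm => h a (Submodule.span_mono (image_mono ha) hm)⟩

theorem countable_span_rat {V : Type*} [AddCommGroup V] [Module ℚ V] {S : Set V}
    (hS : S.Countable) : (Submodule.span ℚ S : Set V).Countable := by
  have := hS.to_subtype
  have h := Finsupp.range_linearCombination ℚ (v := ((↑) : S → V))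
  rw [Subtype.range_coe] at h
  rw [← h]
  exact countable_range _

/-- Along a well-order with countable initial segments, one can choose reals in `C` avoiding `N i`
and the span of the previous choices, as long as no `N i` contains `C` up to a countable set. -/
theorem exists_linearIndependent_notMem {ι : Type*} [LinearOrder ι] [WellFoundedLT ι]
    (hι : ∀ i : ι, (Iio i).Countable) (C : Set ℝ) (N : ι → Set ℝ)
    (hN : ∀ i, ¬ (C \ N i).Countable) :
    ∃ v : ι → ℝ, LinearIndependent ℚ v ∧ ∀ i, v i ∈ C \ N i := by
  have hex : ∀ (i : ι) (f : ∀ j, j < i → ℝ),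
      ∃ x, x ∈ C \ N i ∧ x ∉ Submodule.span ℚ (range fun j : Iio i => f j j.2) := by
    intro i f
    by_contra! hcon
    have := (hι i).to_subtype
    exact hN i ((countable_span_rat (countable_range _)).mono hcon)
  choose F hF hF' using hex
  obtain ⟨v, hv⟩ : ∃ v : ι → ℝ, ∀ i, v i = F i fun j _ => v j :=
    ⟨_, wellFounded_lt.fix_eq F⟩
  refine ⟨v, linearIndependent_of_notMem_span_image_Iio fun i => ?_, fun i => ?_⟩
  · rw [image_eq_range, hv i]
    exact hF' i fun j _ => v j
  · rw [hv i]
    exact hF i fun j _ => v j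

theorem mk_measurableSet_real_le_continuum : #{N : Set ℝ // MeasurableSet N} ≤ 𝔠 := by
  rw [BorelSpace.measurable_eq (α := ℝ), Real.borel_eq_generateFrom_Ioo_rat]
  refine MeasurableSpace.cardinal_measurableSet_le_continuum ?_
  refine le_trans (Countable.le_aleph0 ?_) Cardinal.aleph0_le_continuum
  exact countable_iUnion fun _ => countable_iUnion fun _ => countable_iUnion fun _ => by simp

theorem exists_measurable_superset_dimH_lt {A : Set ℝ} {s : ℝ≥0∞} (h : dimH A < s) :
    ∃ N, A ⊆ N ∧ MeasurableSet N ∧ dimH N < s := by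
  obtain ⟨d, hAd, hds⟩ := ENNReal.lt_iff_exists_nnreal_btwn.1 h
  refine ⟨toMeasurable μH[d] A, subset_toMeasurable _ _, measurableSet_toMeasurable _ _,
    lt_of_le_of_lt (dimH_le_of_hausdorffMeasure_ne_top (d := d) ?_) hds⟩
  rw [measure_toMeasurable, hausdorffMeasure_of_dimH_lt hAd]
  exact ENNReal.zero_ne_top

/-- Under the continuum hypothesis, every set of reals contains a linearly independent
subset of the same dimension. -/
theorem exists_linearIndepOn_subset_dimH_eq (hCH : #(Set ℕ) = Cardinal.aleph 1) (C : Set ℝ) :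
    ∃ A ⊆ C, LinearIndepOn ℚ id A ∧ dimH A = dimH C := by
  set W := {N : {N : Set ℝ // MeasurableSet N} // dimH N.1 < dimH C}
  have hW : #W ≤ Cardinal.aleph 1 := by
    rw [← hCH, Cardinal.mk_set, Cardinal.mk_nat]
    exact (Cardinal.mk_subtype_le _).trans mk_measurableSet_real_le_continuum
  obtain ⟨e⟩ := Cardinal.eq.1 (Cardinal.mk_ord_toType #W)
  obtain ⟨v, hv, hvN⟩ := exists_linearIndependent_notMem
    (fun i => Cardinal.le_aleph0_iff_set_countable.1 <| Cardinal.lt_aleph_one_iff.1 <|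
      (Cardinal.mk_Iio_lt i (by simp)).trans_le (by simpa using hW))
      C (fun i => (e i).1.1) fun i hi => by
        have hsub : C ⊆ (e i).1.1 ∪ C \ (e i).1.1 := by simp
        have := dimH_mono hsub
        rw [dimH_union, dimH_countable hi, max_eq_left zero_le] at this
        exact this.not_gt (e i).2
  have hAC : range v ⊆ C := range_subset_iff.2 fun i => (hvN i).1
  refine ⟨range v, hAC, hv.linearIndepOn_id, (dimH_mono hAC).antisymm ?_⟩
  by_contra! hlt
  obtain ⟨N, hAN, hN, hdim⟩ := exists_measurable_superset_dimH_lt hlt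
  have := (hvN (e.symm ⟨⟨N, hN⟩, hdim⟩)).2
  simp only [Equiv.apply_symm_apply] at this
  exact this (hAN (mem_range_self _))

theorem CH_hamel_basis_dimH (hCH : Cardinal.mk (Set ℕ) = Cardinal.aleph 1)
    (s : ℝ) (hs₀ : 0 < s) (hs₁ : s ≤ 1) :
    ∃ B : Set ℝ, IsHamelBasis B ∧ dimH B = ENNReal.ofReal s := by
  obtain ⟨C, hC⟩ := exists_dimH_eq_ofReal hs₀ hs₁
  obtain ⟨A, -, hA, hAC⟩ := exists_linearIndepOn_subset_dimH_eq hCH C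
  obtain ⟨Z, hZ, hZd, hZ0⟩ := exists_dense_isGδ_dimH_eq_zero
  obtain ⟨B, hBsub, hAB, hspan, hB⟩ := exists_linearIndepOn_id_extension hA
    (subset_union_left (t := Z))
  refine ⟨B, ⟨hB, ?_⟩, le_antisymm ?_ ?_⟩
  · rw [← top_le_iff, ← span_rat_eq_top_of_dense_isGδ hZ hZd, Submodule.span_le]
    exact subset_union_right.trans hspan
  · refine (dimH_mono hBsub).trans ?_
    rw [dimH_union, hZ0, hAC, hC, max_eq_left zero_le]
  · rw [← hC, ← hAC]
    exact dimH_mono hAB
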